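/- The restriction of P_c to ∂D is a bijection from ∂D onto the topological boundary of the convex hull of F. -/

import Mathlib

open Matrix Set

noncomputable section

/-- `A` is irreducible: for every nonempty proper subset `α` of the index set,
the submatrix `A[α, αᶜ]` is not the zero matrix. -/
def IsIrred {k : ℕ} (A : Matrix (Fin k) (Fin k) ℝ) : Prop :=
  ∀ α : Finset (Fin k), α.Nonempty → α ≠ Finset.univ → ∃ i ∈ α, ∃ j ∈ αᶜ, A i j ≠ 0

/-- `A` is a Z-matrix: off-diagonal entries are nonpositive. -/
def IsZmat {k : ℕ} (A : Matrix (Fin k) (Fin k) ℝ) : Prop :=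
  ∀ i j, i ≠ j → A i j ≤ 0

/-- `A` is an M-matrix: a Z-matrix all of whose eigenvalues have nonnegative real part. -/
def IsMmat {k : ℕ} (A : Matrix (Fin k) (Fin k) ℝ) : Prop :=
  IsZmat A ∧ ∀ μ ∈ spectrum ℂ (A.map (Complex.ofReal)), 0 ≤ μ.re

/-- `A` is a nonsingular M-matrix: a Z-matrix all of whose eigenvalues have positive real part. -/
def IsNonsingMmat {k : ℕ} (A : Matrix (Fin k) (Fin k) ℝ) : Prop :=
  IsZmat A ∧ ∀ μ ∈ spectrum ℂ (A.map (Complex.ofReal)), 0 < μ.re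

/-- `P_c(x) = [x] Y (V* − x)`. -/
def Pc {k : ℕ} (Y : Matrix (Fin k) (Fin k) ℝ) (Vs : Fin k → ℝ) (x : Fin k → ℝ) : Fin k → ℝ :=
  Matrix.diagonal x *ᵥ (Y *ᵥ (Vs - x))

/-- Jacobian of `P_c` at `x`: `J(x) = [Y(V* − x)] − [x] Y`. -/
def Jmat {k : ℕ} (Y : Matrix (Fin k) (Fin k) ℝ) (Vs : Fin k → ℝ) (x : Fin k → ℝ) :
    Matrix (Fin k) (Fin k) ℝ :=
  Matrix.diagonal (Y *ᵥ (Vs - x)) - Matrix.diagonal x * Y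

/-- long-term voltage stable operating points. -/
def Dset {k : ℕ} (Y : Matrix (Fin k) (Fin k) ℝ) (Vs : Fin k → ℝ) : Set (Fin k → ℝ) :=
  {x | (∀ i, 0 < x i) ∧ IsUnit (Jmat Y Vs x).det ∧ ∀ i j, (Jmat Y Vs x)⁻¹ i j < 0}

/-- feasible power demands. -/
def Fset {k : ℕ} (Y : Matrix (Fin k) (Fin k) ℝ) (Vs : Fin k → ℝ) : Set (Fin k → ℝ) :=
  {P | ∃ x, (∀ i, 0 < x i) ∧ Pc Y Vs x = P}

/-- `h(λ) = (1/2)([λ] Y + Y [λ])`. -/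
def hmat {k : ℕ} (Y : Matrix (Fin k) (Fin k) ℝ) (l : Fin k → ℝ) : Matrix (Fin k) (Fin k) ℝ :=
  (1/2 : ℝ) • (Matrix.diagonal l * Y + Y * Matrix.diagonal l)

/-- `Λ₁ = {λ ∈ Λ : λ > 0, 1ᵀλ = 1}`. -/
def Lam1 {k : ℕ} (Y : Matrix (Fin k) (Fin k) ℝ) : Set (Fin k → ℝ) :=
  {l | (hmat Y l).PosDef ∧ (∀ i, 0 < l i) ∧ ∑ i, l i = 1}

/-- `φ(λ) = (1/2) h(λ)⁻¹ [λ] I*` where `I* = Y V*`. -/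
def phiv {k : ℕ} (Y : Matrix (Fin k) (Fin k) ℝ) (Vs : Fin k → ℝ) (l : Fin k → ℝ) : Fin k → ℝ :=
  (1/2 : ℝ) • ((hmat Y l)⁻¹ *ᵥ (Matrix.diagonal l *ᵥ (Y *ᵥ Vs)))

/-- `‖x‖_{h(λ)}²  = xᵀ h(λ) x`. -/
def qnorm {k : ℕ} (Y : Matrix (Fin k) (Fin k) ℝ) (l x : Fin k → ℝ) : ℝ :=
  x ⬝ᵥ (hmat Y l *ᵥ x)

/-- The half-space `H_λ`. -/
def Hset {k : ℕ} (Y : Matrix (Fin k) (Fin k) ℝ) (Vs : Fin k → ℝ) (l : Fin k → ℝ) :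
    Set (Fin k → ℝ) :=
  {y | l ⬝ᵥ y ≤ qnorm Y l (phiv Y Vs l)}


section aux
variable {n : ℕ}

lemma aux_S {A : Matrix (Fin n) (Fin n) ℝ} (hZ : IsZmat A) (hirr : IsIrred A)
    {z : Fin n → ℝ} (hz : ∀ i, 0 ≤ z i) (h : ∀ i, z i = 0 → 0 ≤ (A *ᵥ z) i) :
    z = 0 ∨ ∀ i, 0 < z i := by
  by_contra hc
  push Not at hc
  obtain ⟨hz0, i0, hi0⟩ := hc
  have hi0' : z i0 = 0 := le_antisymm hi0 (hz i0)
  obtain ⟨i, hi, j, hj, hij⟩ := hirr (Finset.univ.filter fun i => z i = 0)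
    ⟨i0, by simp [hi0']⟩ (by
      intro he
      apply hz0
      funext k
      have : k ∈ (Finset.univ.filter fun i => z i = 0) := by rw [he]; simp
      simpa using this)
  have hi : z i = 0 := by simpa using hi
  have hj : z j ≠ 0 := by simpa using hj
  have hne : i ≠ j := by rintro rfl; exact hj hi
  have h1 := h i hi
  have h2 : (A *ᵥ z) i < 0 := by
    simp only [Matrix.mulVec, dotProduct]
    apply Finset.sum_neg'
    · intro k _
      by_cases hk : i = k
      · subst hk; simp [hi]
      · exact mul_nonpos_of_nonpos_of_nonneg (hZ i k hk) (hz k)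
    · refine ⟨j, Finset.mem_univ _, mul_neg_of_neg_of_pos ?_ ?_⟩
      · exact lt_of_le_of_ne (hZ i j hne) hij
      · exact lt_of_le_of_ne (hz j) (Ne.symm hj)
  linarith

lemma aux_core (hn : 1 ≤ n) {A : Matrix (Fin n) (Fin n) ℝ} (hZ : IsZmat A) (hirr : IsIrred A)
    {l : Fin n → ℝ} (hl : ∀ i, 0 < l i) (h1 : ∀ i, 0 ≤ (A *ᵥ l) i) (h2 : A *ᵥ l ≠ 0)
    {y : Fin n → ℝ} (hy : ∀ i, 0 ≤ (A *ᵥ y) i) : y = 0 ∨ ∀ i, 0 < y i := by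
  have : Nonempty (Fin n) := ⟨⟨0, hn⟩⟩
  obtain ⟨i0, hi0⟩ := Finite.exists_min (fun i => y i / l i)
  set t := y i0 / l i0 with ht
  have hmin : ∀ i, t * l i ≤ y i := fun i => (le_div_iff₀ (hl i)).1 (hi0 i)
  have he : y i0 = t * l i0 := by rw [ht]; field_simp [(hl i0).ne']
  rcases lt_or_ge 0 t with htp | htn
  · right; intro i; exact lt_of_lt_of_le (mul_pos htp (hl i)) (hmin i)
  have hAz : ∀ i, (A *ᵥ (y - t • l)) i = (A *ᵥ y) i - t * (A *ᵥ l) i := by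
    intro i; simp [Matrix.mulVec_sub, Matrix.mulVec_smul]
  rcases aux_S hZ hirr (z := y - t • l) (fun i => by simp; exact hmin i)
    (fun i _ => by rw [hAz]; have := hy i; have := mul_nonneg (neg_nonneg.2 htn) (h1 i); linarith)
    with h | h
  · left
    rcases htn.lt_or_eq with htl | hte
    · exfalso; apply h2; funext i
      have := hAz i
      rw [h] at this
      simp at this
      have h3 := hy i
      have h4 := h1 i
      have : t * (A *ᵥ l) i ≥ 0 := by linarith
      have : (A *ᵥ l) i ≤ 0 := by nlinarith
      exact le_antisymm this h4
    · rw [hte] at h; simpa using h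
  · have := h i0
    simp [he] at this

lemma irr_transpose {A : Matrix (Fin n) (Fin n) ℝ} (h : IsIrred A) : IsIrred Aᵀ := by
  intro α h1 h2
  obtain ⟨i, hi, j, hj, hij⟩ := h αᶜ (by
    rw [Finset.nonempty_iff_ne_empty]
    intro h; exact h2 (by simpa using h)) (by
    intro h; simp at h; exact h1.ne_empty h)
  exact ⟨j, by simpa using hj, i, hi, hij⟩

lemma irr_of {Y A : Matrix (Fin n) (Fin n) ℝ} (h : IsIrred Y)
    (hA : ∀ i j, i ≠ j → Y i j ≠ 0 → A i j ≠ 0) : IsIrred A := by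
  intro α h1 h2
  obtain ⟨i, hi, j, hj, hij⟩ := h α h1 h2
  refine ⟨i, hi, j, hj, hA i j ?_ hij⟩
  rintro rfl
  simp at hj; exact hj hi

lemma aux_M (hn : 1 ≤ n) {A : Matrix (Fin n) (Fin n) ℝ} (hZ : IsZmat A) (hirr : IsIrred A)
    {l : Fin n → ℝ} (hl : ∀ i, 0 < l i) (h1 : ∀ i, 0 ≤ (Aᵀ *ᵥ l) i) (h2 : Aᵀ *ᵥ l ≠ 0) :
    IsUnit A.det ∧ ∀ i j, 0 < A⁻¹ i j := by
  have hZ' : IsZmat Aᵀ := fun i j h => hZ j i h.symm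
  have hirr' := irr_transpose hirr
  have hcore : ∀ y : Fin n → ℝ, (∀ i, 0 ≤ (Aᵀ *ᵥ y) i) → y = 0 ∨ ∀ i, 0 < y i :=
    fun y hy => aux_core hn hZ' hirr' hl h1 h2 hy
  have hdet : IsUnit Aᵀ.det := by
    rw [isUnit_iff_ne_zero]
    intro h0
    obtain ⟨v, hv, hv0⟩ := Matrix.exists_mulVec_eq_zero_iff.2 h0
    have a1 := hcore v (by simp [hv0])
    have a2 := hcore (-v) (by simp [Matrix.mulVec_neg, hv0])
    rcases a1 with a1 | a1
    · exact hv a1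
    rcases a2 with a2 | a2
    · exact hv (by simpa using a2)
    have b1 := a1 ⟨0, hn⟩
    have b2 := a2 ⟨0, hn⟩
    simp at b2; linarith
  refine ⟨by simpa using hdet, fun i j => ?_⟩
  have hm : Aᵀ *ᵥ (Aᵀ⁻¹ *ᵥ Pi.single i 1) = Pi.single i 1 := by
    rw [Matrix.mulVec_mulVec, Matrix.mul_nonsing_inv _ hdet, Matrix.one_mulVec]
  rcases hcore (Aᵀ⁻¹ *ᵥ Pi.single i 1) (by
    rw [hm]; intro k; by_cases hk : k = i
    · subst hk; simp
    · simp [hk]) with h | h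
  · rw [h] at hm
    have := congrFun hm i
    simp at this
  · have := h j
    rw [Matrix.mulVec_single_one, ← Matrix.transpose_nonsing_inv] at this
    simpa using this

end aux
section aux2
variable {n : ℕ}

def Hm (Y : Matrix (Fin n) (Fin n) ℝ) (l : Fin n → ℝ) : Matrix (Fin n) (Fin n) ℝ :=
  Matrix.of fun i j => (l i + l j) * Y i j

lemma Hm_mulVec (Y : Matrix (Fin n) (Fin n) ℝ) (l x : Fin n → ℝ) (j : Fin n) :
    (Hm Y l *ᵥ x) j = ∑ i, (l j + l i) * Y j i * x i := rfl

lemma NJT {Y : Matrix (Fin n) (Fin n) ℝ} (hs : ∀ i j, Y i j = Y j i) (Vs l x : Fin n → ℝ)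
    (j : Fin n) :
    ((-Jmat Y Vs x)ᵀ *ᵥ l) j = (Hm Y l *ᵥ x) j - l j * (Y *ᵥ Vs) j := by
  rw [Hm_mulVec]
  have e : ∀ i, (-Jmat Y Vs x)ᵀ j i
      = x i * Y j i - (if j = i then (Y *ᵥ Vs) j - (Y *ᵥ x) j else 0) := by
    intro i
    simp only [Jmat, Matrix.transpose_apply, Matrix.neg_apply, Matrix.sub_apply,
      Matrix.diagonal_mul, Matrix.diagonal_apply, Matrix.mulVec_sub, Pi.sub_apply, hs i j]
    by_cases h : i = j
    · subst h; simp
    · simp [h, Ne.symm h]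
  have e2 : ((-Jmat Y Vs x)ᵀ *ᵥ l) j = ∑ i, (-Jmat Y Vs x)ᵀ j i * l i := rfl
  have e3 : (Y *ᵥ x) j = ∑ i, Y j i * x i := rfl
  rw [e2]
  simp only [e, sub_mul, Finset.sum_sub_distrib, ite_mul, zero_mul, Finset.sum_ite_eq,
    Finset.mem_univ, if_true]
  rw [e3]
  simp only [add_mul, Finset.sum_add_distrib, Finset.sum_mul]
  have : ∀ i, l j * Y j i * x i = Y j i * x i * l j := fun i => by ring
  simp only [this]
  have : ∀ i, l i * Y j i * x i = x i * Y j i * l i := fun i => by ring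
  simp only [this]
  ring

lemma NJ_Z {Y : Matrix (Fin n) (Fin n) ℝ} (hZ : IsZmat Y) (Vs : Fin n → ℝ) {x : Fin n → ℝ}
    (hx : ∀ i, 0 ≤ x i) : IsZmat (-Jmat Y Vs x) := by
  intro i j h
  simp [Jmat, h]
  exact mul_nonpos_of_nonneg_of_nonpos (hx i) (hZ i j h)

lemma NJ_irr {Y : Matrix (Fin n) (Fin n) ℝ} (hirr : IsIrred Y) (Vs : Fin n → ℝ) {x : Fin n → ℝ}
    (hx : ∀ i, 0 < x i) : IsIrred (-Jmat Y Vs x) := by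
  apply irr_of hirr
  intro i j h h2
  simp [Jmat, h, h2, (hx i).ne']

lemma mem_D (hn : 1 ≤ n) {Y : Matrix (Fin n) (Fin n) ℝ} (hs : ∀ i j, Y i j = Y j i)
    (hZ : IsZmat Y) (hirr : IsIrred Y) {Vs l x : Fin n → ℝ} (hx : ∀ i, 0 < x i)
    (hl : ∀ i, 0 < l i) (h1 : ∀ j, 0 ≤ (Hm Y l *ᵥ x) j - l j * (Y *ᵥ Vs) j)
    (h2 : ∃ j, (Hm Y l *ᵥ x) j - l j * (Y *ᵥ Vs) j ≠ 0) : x ∈ Dset Y Vs := by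
  obtain ⟨a, b⟩ := aux_M hn (NJ_Z hZ Vs fun i => (hx i).le) (NJ_irr hirr Vs hx) hl
    (fun j => by rw [NJT hs]; exact h1 j) (by
      intro h; obtain ⟨j, hj⟩ := h2
      rw [← NJT hs, h] at hj; exact hj rfl)
  have ha : IsUnit (Jmat Y Vs x).det := by
    rw [← Matrix.isUnit_iff_isUnit_det] at a ⊢
    exact (IsUnit.neg_iff _).1 a
  refine ⟨hx, ha, fun i j => ?_⟩
  have : (-Jmat Y Vs x)⁻¹ = -(Jmat Y Vs x)⁻¹ := by
    apply Matrix.inv_eq_left_inv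
    rw [neg_mul_neg, Matrix.nonsing_inv_mul _ ha]
  have hb := b i j
  rw [this] at hb
  simpa using hb

lemma D_l (hn : 1 ≤ n) {Y : Matrix (Fin n) (Fin n) ℝ} (hs : ∀ i j, Y i j = Y j i)
    {Vs x : Fin n → ℝ} (hx : x ∈ Dset Y Vs) :
    ∃ l : Fin n → ℝ, (∀ i, 0 < l i) ∧ ∑ i, l i = 1 ∧
      ∀ j, 0 < (Hm Y l *ᵥ x) j - l j * (Y *ᵥ Vs) j := by
  obtain ⟨h0, hu, hneg⟩ := hx
  have : Nonempty (Fin n) := ⟨⟨0, hn⟩⟩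
  set l : Fin n → ℝ := (-(Jmat Y Vs x)⁻¹)ᵀ *ᵥ 1 with hl
  have hlp : ∀ i, 0 < l i := by
    intro i
    have : l i = ∑ j, -(Jmat Y Vs x)⁻¹ j i := by
      simp [hl, Matrix.mulVec, dotProduct]
    rw [this]
    exact Finset.sum_pos (fun j _ => by linarith [hneg j i]) Finset.univ_nonempty
  have hJ : (-Jmat Y Vs x)ᵀ *ᵥ l = 1 := by
    rw [hl, Matrix.mulVec_mulVec, ← Matrix.transpose_mul, neg_mul_neg,
      Matrix.nonsing_inv_mul _ hu]
    simp
  clear_value l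
  have hsum : 0 < ∑ i, l i := Finset.sum_pos (fun j _ => hlp j) Finset.univ_nonempty
  refine ⟨(∑ i, l i)⁻¹ • l, fun i => ?_, ?_, fun j => ?_⟩
  · simp only [Pi.smul_apply, smul_eq_mul]; exact mul_pos (inv_pos.2 hsum) (hlp i)
  · simp only [Pi.smul_apply, smul_eq_mul]
    rw [← Finset.mul_sum, inv_mul_cancel₀ hsum.ne']
  · rw [← NJT hs, Matrix.mulVec_smul, hJ]
    simpa using hsum

lemma D_diag (hn : 1 ≤ n) {Y : Matrix (Fin n) (Fin n) ℝ}
    (hZ : IsZmat Y) {Vs x : Fin n → ℝ} (hx : x ∈ Dset Y Vs) (i : Fin n) :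
    0 < x i * Y i i - ((Y *ᵥ Vs) i - (Y *ᵥ x) i) := by
  obtain ⟨h0, hu, hneg⟩ := hx
  have : Nonempty (Fin n) := ⟨⟨0, hn⟩⟩
  set l : Fin n → ℝ := (-(Jmat Y Vs x)⁻¹) *ᵥ 1 with hl
  have hlp : ∀ i, 0 < l i := by
    intro i
    have : l i = ∑ j, -(Jmat Y Vs x)⁻¹ i j := by
      simp [hl, Matrix.mulVec, dotProduct]
    rw [this]
    exact Finset.sum_pos (fun j _ => by linarith [hneg i j]) Finset.univ_nonempty
  have hJ : (-Jmat Y Vs x) *ᵥ l = 1 := by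
    rw [hl, Matrix.mulVec_mulVec, neg_mul_neg,
      Matrix.mul_nonsing_inv _ hu]
    simp
  have e : (-Jmat Y Vs x) i i = x i * Y i i - ((Y *ᵥ Vs) i - (Y *ᵥ x) i) := by
    simp [Jmat, Matrix.mulVec_sub]
  have hJi : ∑ j, (-Jmat Y Vs x) i j * l j = 1 := congrFun hJ i
  rw [← Finset.add_sum_erase _ _ (Finset.mem_univ i), e] at hJi
  have : ∑ j ∈ Finset.univ.erase i, (-Jmat Y Vs x) i j * l j ≤ 0 := by
    apply Finset.sum_nonpos
    intro j hj
    have hj : i ≠ j := fun h => by simp [h] at hj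
    exact mul_nonpos_of_nonpos_of_nonneg (NJ_Z hZ Vs (fun i => (h0 i).le) i j hj) (hlp j).le
  by_contra hc
  have := mul_nonpos_of_nonpos_of_nonneg (not_lt.1 hc) (hlp i).le
  linarith

def Good (Y : Matrix (Fin n) (Fin n) ℝ) (Vs l x : Fin n → ℝ) : Prop :=
  (∀ i, 0 < l i) ∧ (∀ i, 0 < x i) ∧ ∀ j, (Hm Y l *ᵥ x) j = l j * (Y *ᵥ Vs) j

lemma Hm_cont (Y : Matrix (Fin n) (Fin n) ℝ) (j : Fin n) :
    Continuous fun p : (Fin n → ℝ) × (Fin n → ℝ) => (Hm Y p.1 *ᵥ p.2) j := by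
  simp only [Hm_mulVec]
  fun_prop

lemma mv_cont (Y : Matrix (Fin n) (Fin n) ℝ) (j : Fin n) :
    Continuous fun p : (Fin n → ℝ) => (Y *ᵥ p) j := by
  simp only [Matrix.mulVec, dotProduct]
  fun_prop

lemma D_open (hn : 1 ≤ n) {Y : Matrix (Fin n) (Fin n) ℝ} (hs : ∀ i j, Y i j = Y j i)
    (hZ : IsZmat Y) (hirr : IsIrred Y) (Vs : Fin n → ℝ) : IsOpen (Dset Y Vs) := by
  rw [isOpen_iff_mem_nhds]
  intro x hx
  obtain ⟨l, hl, -, h⟩ := D_l hn hs hx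
  have h1 : ∀ i, ∀ᶠ y in nhds x, 0 < y i := fun i =>
    (continuous_apply i).continuousAt.eventually_const_lt (hx.1 i)
  have h2 : ∀ j, ∀ᶠ y in nhds x, 0 < (Hm Y l *ᵥ y) j - l j * (Y *ᵥ Vs) j := fun j => by
    have : Continuous fun y => (Hm Y l *ᵥ y) j - l j * (Y *ᵥ Vs) j :=
      (mv_cont _ j).sub continuous_const
    exact this.continuousAt.eventually_const_lt (h j)
  filter_upwards [Filter.eventually_all.2 h1, Filter.eventually_all.2 h2] with y hy1 hy2
  exact mem_D hn hs hZ hirr hy1 hl (fun j => (hy2 j).le) ⟨⟨0, hn⟩, (hy2 _).ne'⟩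

lemma closure_pos (hn : 1 ≤ n) {Y : Matrix (Fin n) (Fin n) ℝ}
    (hZ : IsZmat Y) (hirr : IsIrred Y) {Vs : Fin n → ℝ}
    (hInn : ∀ i, 0 ≤ (Y *ᵥ Vs) i) (hIne : Y *ᵥ Vs ≠ 0) {x : Fin n → ℝ}
    (hx : x ∈ closure (Dset Y Vs)) : ∀ i, 0 < x i := by
  have h0 : ∀ i, 0 ≤ x i := by
    intro i
    have : closure (Dset Y Vs) ⊆ {x | 0 ≤ x i} :=
      closure_minimal (fun y hy => (hy.1 i).le)
        (isClosed_le continuous_const (continuous_apply i))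
    exact this hx
  have h1 : ∀ i, 0 ≤ x i * Y i i - ((Y *ᵥ Vs) i - (Y *ᵥ x) i) := by
    intro i
    have : closure (Dset Y Vs) ⊆ {x | 0 ≤ x i * Y i i - ((Y *ᵥ Vs) i - (Y *ᵥ x) i)} :=
      closure_minimal (fun y hy => (D_diag hn hZ hy i).le)
        (isClosed_le continuous_const (by
          have := mv_cont Y i
          fun_prop))
    exact this hx
  rcases aux_S hZ hirr h0 (fun i hi => by
    have := h1 i; rw [hi] at this; have := hInn i; linarith) with h | h
  · exfalso; apply hIne; funext i
    have := h1 i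
    simp [h] at this
    exact le_antisymm this (hInn i)
  · exact h

lemma lim_aux (Y : Matrix (Fin n) (Fin n) ℝ) (Vs : Fin n → ℝ) {l u : ℕ → Fin n → ℝ}
    {L x : Fin n → ℝ} (hl : Filter.Tendsto l Filter.atTop (nhds L))
    (hu : Filter.Tendsto u Filter.atTop (nhds x)) (j : Fin n)
    (h : ∀ m, 0 ≤ (Hm Y (l m) *ᵥ (u m)) j - l m j * (Y *ᵥ Vs) j) :
    0 ≤ (Hm Y L *ᵥ x) j - L j * (Y *ᵥ Vs) j := by
  have hcl : IsClosed {p : (Fin n → ℝ) × (Fin n → ℝ) |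
      0 ≤ (Hm Y p.1 *ᵥ p.2) j - p.1 j * (Y *ᵥ Vs) j} :=
    isClosed_le continuous_const
      ((Hm_cont Y j).sub (((continuous_apply j).comp continuous_fst).mul continuous_const))
  have hp := hl.prodMk_nhds hu
  have := hcl.mem_of_tendsto hp (Filter.Eventually.of_forall h)
  exact this

lemma frontier_good (hn : 1 ≤ n) {Y : Matrix (Fin n) (Fin n) ℝ} (hs : ∀ i j, Y i j = Y j i)
    (hZ : IsZmat Y) (hirr : IsIrred Y) {Vs : Fin n → ℝ}
    (hInn : ∀ i, 0 ≤ (Y *ᵥ Vs) i) (hIne : Y *ᵥ Vs ≠ 0) {x : Fin n → ℝ}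
    (hx : x ∈ frontier (Dset Y Vs)) : ∃ l, Good Y Vs l x := by
  rw [(D_open hn hs hZ hirr Vs).frontier_eq] at hx
  obtain ⟨hxc, hxD⟩ := hx
  have hxp := closure_pos hn hZ hirr hInn hIne hxc
  obtain ⟨u, hu, hux⟩ := mem_closure_iff_seq_limit.1 hxc
  choose l hl1 hl2 hl3 using fun m => D_l hn hs (hu m)
  obtain ⟨L, hL, φ, hφ, hlim⟩ := (isCompact_stdSimplex ℝ (Fin n)).tendsto_subseq (x := l)
    (fun m => ⟨fun i => (hl1 m i).le, hl2 m⟩)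
  have hLge : ∀ j, 0 ≤ (Hm Y L *ᵥ x) j - L j * (Y *ᵥ Vs) j := by
    intro j
    exact lim_aux Y Vs hlim (hux.comp hφ.tendsto_atTop) j (fun m => (hl3 (φ m) j).le)
  have hLp : ∀ i, 0 < L i := by
    rcases aux_S (A := (-Jmat Y Vs x)ᵀ) (z := L)
      (fun i j h => NJ_Z hZ Vs (fun i => (hxp i).le) j i h.symm)
      (irr_transpose (NJ_irr hirr Vs hxp)) hL.1 (fun i _ => by rw [NJT hs]; exact hLge i) with h | h
    · have := hL.2
      simp [h] at this
    · exact h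
  refine ⟨L, hLp, hxp, fun j => ?_⟩
  by_contra hne
  exact hxD (mem_D hn hs hZ hirr hxp hLp hLge ⟨j, sub_ne_zero.2 hne⟩)

lemma good_frontier (hn : 1 ≤ n) {Y : Matrix (Fin n) (Fin n) ℝ} (hs : ∀ i j, Y i j = Y j i)
    (hZ : IsZmat Y) (hirr : IsIrred Y) {Vs : Fin n → ℝ}
    (hInn : ∀ i, 0 ≤ (Y *ᵥ Vs) i) (hIne : Y *ᵥ Vs ≠ 0) {l x : Fin n → ℝ}
    (hg : Good Y Vs l x) : x ∈ frontier (Dset Y Vs) := by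
  rw [(D_open hn hs hZ hirr Vs).frontier_eq]
  obtain ⟨hl, hx, h⟩ := hg
  constructor
  · have ht : Filter.Tendsto (fun t : ℝ => (1 + t) • x) (nhdsWithin 0 (Ioi 0)) (nhds x) := by
      have hc : Continuous (fun t : ℝ => (1 + t) • x) := by fun_prop
      have := hc.tendsto 0
      simp only [add_zero, one_smul] at this
      exact this.mono_left nhdsWithin_le_nhds
    apply mem_closure_of_tendsto ht
    filter_upwards [self_mem_nhdsWithin] with t ht
    have ht : 0 < t := ht
    have e : ∀ j, (Hm Y l *ᵥ ((1 + t) • x)) j - l j * (Y *ᵥ Vs) j = t * (l j * (Y *ᵥ Vs) j) := by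
      intro j
      rw [Matrix.mulVec_smul]
      simp only [Pi.smul_apply, smul_eq_mul, h j]; ring
    apply mem_D hn hs hZ hirr (l := l) (fun i => by
      simp only [Pi.smul_apply, smul_eq_mul]; have := hx i; positivity) hl
    · intro j; rw [e]; have := hl j; have := hInn j; positivity
    · obtain ⟨j, hj⟩ := Function.ne_iff.1 hIne
      refine ⟨j, ?_⟩
      rw [e]
      exact mul_ne_zero ht.ne' (mul_ne_zero (hl j).ne' hj)
  · intro hD
    have h0 : (-Jmat Y Vs x)ᵀ *ᵥ l = 0 := by
      funext j; rw [NJT hs, h j]; simp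
    have hd : ((-Jmat Y Vs x)ᵀ).det = 0 :=
      Matrix.exists_mulVec_eq_zero_iff.1 ⟨l, fun h => by
        have := hl ⟨0, hn⟩; simp [h] at this, h0⟩
    rw [Matrix.det_transpose, Matrix.det_neg] at hd
    have := hD.2.1.ne_zero
    simp at hd
    exact this hd

end aux2
section aux3
variable {n : ℕ}

lemma Pc_apply (Y : Matrix (Fin n) (Fin n) ℝ) (Vs x : Fin n → ℝ) (i : Fin n) :
    Pc Y Vs x i = x i * ((Y *ᵥ Vs) i - (Y *ᵥ x) i) := by
  simp [Pc, Matrix.mulVec_diagonal, Matrix.mulVec_sub]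

lemma dot_eq (H : Matrix (Fin n) (Fin n) ℝ) (y z : Fin n → ℝ) :
    y ⬝ᵥ (H *ᵥ z) = ∑ i, ∑ j, H i j * y i * z j := by
  simp only [dotProduct, Matrix.mulVec, Finset.mul_sum]
  exact Finset.sum_congr rfl fun i _ => Finset.sum_congr rfl fun j _ => by ring

lemma dot_symm {H : Matrix (Fin n) (Fin n) ℝ} (hs : ∀ i j, H i j = H j i) (y z : Fin n → ℝ) :
    y ⬝ᵥ (H *ᵥ z) = z ⬝ᵥ (H *ᵥ y) := by
  rw [dot_eq, dot_eq, Finset.sum_comm]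
  exact Finset.sum_congr rfl fun i _ => Finset.sum_congr rfl fun j _ => by rw [hs j i]; ring

lemma Q_sub {H : Matrix (Fin n) (Fin n) ℝ} (hs : ∀ i j, H i j = H j i) (y z : Fin n → ℝ) :
    (y - z) ⬝ᵥ (H *ᵥ (y - z)) = y ⬝ᵥ (H *ᵥ y) - 2 * (y ⬝ᵥ (H *ᵥ z)) + z ⬝ᵥ (H *ᵥ z) := by
  rw [Matrix.mulVec_sub, sub_dotProduct, dotProduct_sub, dotProduct_sub, dot_symm hs z y]
  ring

lemma Hm_symm {Y : Matrix (Fin n) (Fin n) ℝ} (hs : ∀ i j, Y i j = Y j i) (l : Fin n → ℝ) :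
    ∀ i j, Hm Y l i j = Hm Y l j i := by
  intro i j; simp only [Hm, Matrix.of_apply, hs i j]; ring

lemma Hm_Z {Y : Matrix (Fin n) (Fin n) ℝ} (hZ : IsZmat Y) {l : Fin n → ℝ} (hl : ∀ i, 0 < l i) :
    IsZmat (Hm Y l) := by
  intro i j h
  simp only [Hm, Matrix.of_apply]
  exact mul_nonpos_of_nonneg_of_nonpos (add_pos (hl i) (hl j)).le (hZ i j h)

lemma Hm_irr {Y : Matrix (Fin n) (Fin n) ℝ} (hirr : IsIrred Y) {l : Fin n → ℝ}
    (hl : ∀ i, 0 < l i) : IsIrred (Hm Y l) := by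
  apply irr_of hirr
  intro i j _ h
  simp only [Hm, Matrix.of_apply]
  exact mul_ne_zero (add_pos (hl i) (hl j)).ne' h

lemma lPc {Y : Matrix (Fin n) (Fin n) ℝ} (hs : ∀ i j, Y i j = Y j i) (Vs l y : Fin n → ℝ) :
    l ⬝ᵥ Pc Y Vs y = ∑ i, l i * y i * (Y *ᵥ Vs) i - (y ⬝ᵥ (Hm Y l *ᵥ y)) / 2 := by
  have e1 : l ⬝ᵥ Pc Y Vs y = ∑ i, l i * y i * (Y *ᵥ Vs) i - ∑ i, ∑ j, l i * Y i j * y i * y j := by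
    simp only [dotProduct, Pc_apply]
    rw [← Finset.sum_sub_distrib]
    refine Finset.sum_congr rfl fun i _ => ?_
    have : (Y *ᵥ y) i = ∑ j, Y i j * y j := rfl
    have e : ∑ j, l i * Y i j * y i * y j = l i * y i * (Y *ᵥ y) i := by
      rw [this, Finset.mul_sum]
      exact Finset.sum_congr rfl fun j _ => by ring
    rw [e]; ring
  have e2 : y ⬝ᵥ (Hm Y l *ᵥ y) = ∑ i, ∑ j, l i * Y i j * y i * y j
      + ∑ i, ∑ j, l j * Y i j * y i * y j := by
    rw [dot_eq, ← Finset.sum_add_distrib]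
    refine Finset.sum_congr rfl fun i _ => ?_
    rw [← Finset.sum_add_distrib]
    refine Finset.sum_congr rfl fun j _ => ?_
    simp only [Hm, Matrix.of_apply]; ring
  have e3 : ∑ i, ∑ j, l j * Y i j * y i * y j = ∑ i, ∑ j, l i * Y i j * y i * y j := by
    rw [Finset.sum_comm]
    exact Finset.sum_congr rfl fun i _ => Finset.sum_congr rfl fun j _ => by rw [hs j i]; ring
  rw [e1, e2, e3]; ring

lemma good_eq {Y : Matrix (Fin n) (Fin n) ℝ} (hs : ∀ i j, Y i j = Y j i) {Vs l x : Fin n → ℝ}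
    (hg : Good Y Vs l x) (y : Fin n → ℝ) :
    l ⬝ᵥ Pc Y Vs y = l ⬝ᵥ Pc Y Vs x - ((y - x) ⬝ᵥ (Hm Y l *ᵥ (y - x))) / 2 := by
  have h : ∀ y : Fin n → ℝ, ∑ i, l i * y i * (Y *ᵥ Vs) i = y ⬝ᵥ (Hm Y l *ᵥ x) := by
    intro y
    simp only [dotProduct, hg.2.2]
    exact Finset.sum_congr rfl fun j _ => by ring
  rw [lPc hs, lPc hs, Q_sub (Hm_symm hs l), h, h]
  ring

lemma psd_aux {H : Matrix (Fin n) (Fin n) ℝ} (hs : ∀ i j, H i j = H j i) (hZ : IsZmat H)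
    {x : Fin n → ℝ} (hx : ∀ i, 0 < x i) (h : ∀ i, 0 ≤ (H *ᵥ x) i) (z : Fin n → ℝ) :
    0 ≤ z ⬝ᵥ (H *ᵥ z) := by
  have key : ∀ i j, H i j * x j * (z i ^ 2 / x i) / 2 + H j i * x i * (z j ^ 2 / x j) / 2
      ≤ H i j * z i * z j := by
    intro i j
    have hi := hx i
    have hj := hx j
    by_cases hij : i = j
    · subst hij
      apply le_of_eq; field_simp; ring
    · have e : H i j * z i * z j - (H i j * x j * (z i ^ 2 / x i) / 2
          + H i j * x i * (z j ^ 2 / x j) / 2)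
          = (- H i j) * ((z i * x j - z j * x i) ^ 2 / (2 * x i * x j)) := by
        field_simp; ring
      have : 0 ≤ (- H i j) * ((z i * x j - z j * x i) ^ 2 / (2 * x i * x j)) :=
        mul_nonneg (by linarith [hZ i j hij]) (by positivity)
      rw [hs j i]
      linarith
  have e1 : ∑ i, ∑ j, H i j * x j * (z i ^ 2 / x i) / 2 = ∑ i, (H *ᵥ x) i * (z i ^ 2 / x i) / 2 := by
    refine Finset.sum_congr rfl fun i _ => ?_
    have : (H *ᵥ x) i = ∑ j, H i j * x j := rfl
    rw [this, Finset.sum_mul, Finset.sum_div]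
  have e2 : ∑ i, ∑ j, H j i * x i * (z j ^ 2 / x j) / 2
      = ∑ i, ∑ j, H i j * x j * (z i ^ 2 / x i) / 2 := Finset.sum_comm
  rw [dot_eq]
  calc (0:ℝ) ≤ ∑ i, (H *ᵥ x) i * (z i ^ 2 / x i) / 2 + ∑ i, (H *ᵥ x) i * (z i ^ 2 / x i) / 2 := by
        have : 0 ≤ ∑ i, (H *ᵥ x) i * (z i ^ 2 / x i) / 2 := Finset.sum_nonneg fun i _ => by
          have := h i; have := hx i; positivity
        linarith
    _ = ∑ i, ∑ j, (H i j * x j * (z i ^ 2 / x i) / 2 + H j i * x i * (z j ^ 2 / x j) / 2) := by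
        simp only [Finset.sum_add_distrib]
        rw [e2, e1]
    _ ≤ _ := Finset.sum_le_sum fun i _ => Finset.sum_le_sum fun j _ => key i j

lemma mkPSD {H : Matrix (Fin n) (Fin n) ℝ} (hs : ∀ i j, H i j = H j i)
    (h : ∀ z, 0 ≤ z ⬝ᵥ (H *ᵥ z)) : H.PosSemidef :=
  Matrix.PosSemidef.of_dotProduct_mulVec_nonneg (by
    ext i j; simp [hs j i]) (fun z => by simpa using h z)

lemma good_PD (hn : 1 ≤ n) {Y : Matrix (Fin n) (Fin n) ℝ} (hs : ∀ i j, Y i j = Y j i)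
    (hZ : IsZmat Y) (hirr : IsIrred Y) {Vs : Fin n → ℝ}
    (hInn : ∀ i, 0 ≤ (Y *ᵥ Vs) i) (hIne : Y *ᵥ Vs ≠ 0) {l x : Fin n → ℝ}
    (hg : Good Y Vs l x) : (Hm Y l).PosDef := by
  obtain ⟨hl, hx, h⟩ := hg
  have hH : ∀ i, 0 ≤ (Hm Y l *ᵥ x) i := fun i => by
    rw [h]; exact mul_nonneg (hl i).le (hInn i)
  have hP := mkPSD (Hm_symm hs l) (psd_aux (Hm_symm hs l) (Hm_Z hZ hl) hx hH)
  rw [hP.posDef_iff_isUnit, Matrix.isUnit_iff_isUnit_det]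
  have ht : (Hm Y l)ᵀ = Hm Y l := by ext i j; exact Hm_symm hs l j i
  refine (aux_M hn (Hm_Z hZ hl) (Hm_irr hirr hl) hx (by rw [ht]; exact hH) ?_).1
  rw [ht]
  intro h0
  apply hIne
  funext i
  have := h i
  rw [h0] at this
  simpa [(hl i).ne'] using this.symm

lemma PD_pos {H : Matrix (Fin n) (Fin n) ℝ} (hP : H.PosDef) {z : Fin n → ℝ} (hz : z ≠ 0) :
    0 < z ⬝ᵥ (H *ᵥ z) := by simpa using hP.dotProduct_mulVec_pos hz

lemma kappa (hn : 1 ≤ n) {H : Matrix (Fin n) (Fin n) ℝ} (hP : H.PosDef) :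
    ∃ κ : ℝ, 0 < κ ∧ ∀ z, κ * ‖z‖ ^ 2 ≤ z ⬝ᵥ (H *ᵥ z) := by
  have : Nonempty (Fin n) := ⟨⟨0, hn⟩⟩
  have hc : Continuous fun z : Fin n → ℝ => z ⬝ᵥ (H *ᵥ z) := by
    simp only [dot_eq]; fun_prop
  obtain ⟨z0, hz0, hmin⟩ := (isCompact_sphere (0 : Fin n → ℝ) 1).exists_isMinOn
    (NormedSpace.sphere_nonempty.2 zero_le_one) hc.continuousOn
  have hz0' : z0 ≠ 0 := by
    rintro rfl; simp at hz0
  refine ⟨z0 ⬝ᵥ (H *ᵥ z0), PD_pos hP hz0', fun z => ?_⟩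
  by_cases hz : z = 0
  · simp [hz]
  have hzn : 0 < ‖z‖ := norm_pos_iff.2 hz
  have h1 : (‖z‖⁻¹ • z) ∈ Metric.sphere (0 : Fin n → ℝ) 1 := by
    simp [norm_smul, hzn.ne']
  have h2 : z0 ⬝ᵥ (H *ᵥ z0) ≤ (‖z‖⁻¹ • z) ⬝ᵥ (H *ᵥ (‖z‖⁻¹ • z)) := hmin h1
  rw [Matrix.mulVec_smul, smul_dotProduct, dotProduct_smul, smul_eq_mul, smul_eq_mul] at h2
  have h3 := mul_le_mul_of_nonneg_right h2 (sq_nonneg ‖z‖)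
  have : ‖z‖⁻¹ * (‖z‖⁻¹ * z ⬝ᵥ H *ᵥ z) * ‖z‖ ^ 2 = z ⬝ᵥ H *ᵥ z := by field_simp
  linarith

lemma mv_bound (Y : Matrix (Fin n) (Fin n) ℝ) (i : Fin n) (z : Fin n → ℝ) :
    |(Y *ᵥ z) i| ≤ (∑ j, |Y i j|) * ‖z‖ := by
  have : (Y *ᵥ z) i = ∑ j, Y i j * z j := rfl
  rw [this, Finset.sum_mul]
  refine (Finset.abs_sum_le_sum_abs _ _).trans (Finset.sum_le_sum fun j _ => ?_)
  rw [abs_mul]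
  exact mul_le_mul_of_nonneg_left (norm_le_pi_norm z j) (abs_nonneg _)

lemma Pc_bound (Y : Matrix (Fin n) (Fin n) ℝ) (Vs x : Fin n → ℝ) (i : Fin n) :
    ∃ A B : ℝ, 0 ≤ A ∧ 0 ≤ B ∧ ∀ y, |Pc Y Vs y i - Pc Y Vs x i|
      ≤ A * ‖y - x‖ + B * ‖y - x‖ ^ 2 := by
  have hC : 0 ≤ ∑ j, |Y i j| := Finset.sum_nonneg fun j _ => abs_nonneg _
  refine ⟨|(Y *ᵥ Vs) i - (Y *ᵥ x) i| + |x i| * ∑ j, |Y i j|, ∑ j, |Y i j|, by positivity, hC,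
    fun y => ?_⟩
  have h1 := mv_bound Y i (y - x)
  have h2 : |(y - x) i| ≤ ‖y - x‖ := norm_le_pi_norm (y - x) i
  have e : Pc Y Vs y i - Pc Y Vs x i = (y - x) i * ((Y *ᵥ Vs) i - (Y *ᵥ x) i)
      - x i * (Y *ᵥ (y - x)) i - (y - x) i * (Y *ᵥ (y - x)) i := by
    rw [Pc_apply, Pc_apply, Matrix.mulVec_sub]; simp only [Pi.sub_apply]; ring
  rw [e]
  have a1 : |(y - x) i * ((Y *ᵥ Vs) i - (Y *ᵥ x) i)|
      ≤ ‖y - x‖ * |(Y *ᵥ Vs) i - (Y *ᵥ x) i| := by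
    rw [abs_mul]; exact mul_le_mul_of_nonneg_right h2 (abs_nonneg _)
  have a2 : |x i * (Y *ᵥ (y - x)) i| ≤ |x i| * ((∑ j, |Y i j|) * ‖y - x‖) := by
    rw [abs_mul]; exact mul_le_mul_of_nonneg_left h1 (abs_nonneg _)
  have a3 : |(y - x) i * (Y *ᵥ (y - x)) i| ≤ ‖y - x‖ * ((∑ j, |Y i j|) * ‖y - x‖) := by
    rw [abs_mul]; exact mul_le_mul h2 h1 (abs_nonneg _) (norm_nonneg _)
  have b1 := abs_sub ((y - x) i * ((Y *ᵥ Vs) i - (Y *ᵥ x) i)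
      - x i * (Y *ᵥ (y - x)) i) ((y - x) i * (Y *ᵥ (y - x)) i)
  have b2 := abs_sub ((y - x) i * ((Y *ᵥ Vs) i - (Y *ᵥ x) i)) (x i * (Y *ᵥ (y - x)) i)
  nlinarith

lemma hull_le {S : Set (Fin n → ℝ)} {m : Fin n → ℝ} {k : ℝ} (h : ∀ y ∈ S, m ⬝ᵥ y ≤ k)
    {P : Fin n → ℝ} (hP : P ∈ closure (convexHull ℝ S)) : m ⬝ᵥ P ≤ k := by
  have hc : Continuous fun y : Fin n → ℝ => m ⬝ᵥ y := by
    simp only [dotProduct]; fun_prop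
  have hconv : Convex ℝ {y : Fin n → ℝ | m ⬝ᵥ y ≤ k} :=
    convex_halfSpace_le ⟨fun a b => dotProduct_add _ _ _, fun c a => dotProduct_smul _ _ _⟩ k
  exact closure_minimal (convexHull_min (fun y hy => h y hy) hconv)
    (isClosed_le hc continuous_const) hP

lemma good_uniq (hn : 1 ≤ n) {Y : Matrix (Fin n) (Fin n) ℝ} (hs : ∀ i j, Y i j = Y j i)
    (hZ : IsZmat Y) (hirr : IsIrred Y) {Vs : Fin n → ℝ}
    (hInn : ∀ i, 0 ≤ (Y *ᵥ Vs) i) (hIne : Y *ᵥ Vs ≠ 0) {l x : Fin n → ℝ}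
    (hg : Good Y Vs l x) {P : Fin n → ℝ} (hP : P ∈ closure (convexHull ℝ (Fset Y Vs)))
    (hle : l ⬝ᵥ Pc Y Vs x ≤ l ⬝ᵥ P) : P = Pc Y Vs x := by
  obtain ⟨κ, hκ, hq⟩ := kappa hn (good_PD hn hs hZ hirr hInn hIne hg)
  funext i
  obtain ⟨A, B, hA, hB, hb⟩ := Pc_bound Y Vs x i
  have key : ∀ s : ℝ, |s| ≤ 1 → ∀ ε : ℝ, 0 < ε → s * P i ≤ s * Pc Y Vs x i + ε := by
    intro s hsn ε hε
    set C : ℝ := (A ^ 2 / (4 * ε) + B) * (2 / κ) with hC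
    have hC0 : 0 ≤ C := by positivity
    have hF : ∀ y ∈ Fset Y Vs, (Pi.single i s + C • l) ⬝ᵥ y
        ≤ s * Pc Y Vs x i + ε + C * (l ⬝ᵥ Pc Y Vs x) := by
      rintro _ ⟨y, -, rfl⟩
      rw [add_dotProduct, smul_dotProduct, single_dotProduct, smul_eq_mul, good_eq hs hg y]
      have h1 := hb y
      have h2 := hq (y - x)
      set N := ‖y - x‖
      set q := (y - x) ⬝ᵥ (Hm Y l *ᵥ (y - x))
      have h3 : s * (Pc Y Vs y i - Pc Y Vs x i) ≤ |Pc Y Vs y i - Pc Y Vs x i| := by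
        refine (le_abs_self _).trans ?_
        rw [abs_mul]
        exact mul_le_of_le_one_left (abs_nonneg _) hsn
      have h4 : A * N ≤ ε + A ^ 2 / (4 * ε) * N ^ 2 := by
        have : ε + A ^ 2 / (4 * ε) * N ^ 2 - A * N = (2 * ε - A * N) ^ 2 / (4 * ε) := by
          field_simp; ring
        have : 0 ≤ (2 * ε - A * N) ^ 2 / (4 * ε) := by positivity
        linarith
      have h5 : (A ^ 2 / (4 * ε) + B) * N ^ 2 ≤ C * (q / 2) := by
        have : N ^ 2 ≤ q / κ := by rw [le_div_iff₀ hκ]; linarith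
        have e : C * (q / 2) = (A ^ 2 / (4 * ε) + B) * (q / κ) := by rw [hC]; field_simp
        rw [e]
        exact mul_le_mul_of_nonneg_left this (by positivity)
      linarith
    have h := hull_le hF hP
    rw [add_dotProduct, smul_dotProduct, single_dotProduct, smul_eq_mul] at h
    have := mul_le_mul_of_nonneg_left hle hC0
    linarith
  apply le_antisymm
  · refine le_of_forall_pos_le_add fun ε hε => ?_
    have := key 1 (by simp) ε hε
    linarith
  · refine le_of_forall_pos_le_add fun ε hε => ?_
    have := key (-1) (by simp) ε hε
    linarith

lemma good_max (hn : 1 ≤ n) {Y : Matrix (Fin n) (Fin n) ℝ} (hs : ∀ i j, Y i j = Y j i)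
    (hZ : IsZmat Y) (hirr : IsIrred Y) {Vs : Fin n → ℝ}
    (hInn : ∀ i, 0 ≤ (Y *ᵥ Vs) i) (hIne : Y *ᵥ Vs ≠ 0) {l x : Fin n → ℝ}
    (hg : Good Y Vs l x) : Pc Y Vs x ∈ frontier (convexHull ℝ (Fset Y Vs)) := by
  have hPD := good_PD hn hs hZ hirr hInn hIne hg
  refine ⟨subset_closure (subset_convexHull ℝ _ ⟨x, hg.2.1, rfl⟩), fun hint => ?_⟩
  have hF : ∀ y ∈ Fset Y Vs, l ⬝ᵥ y ≤ l ⬝ᵥ Pc Y Vs x := by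
    rintro _ ⟨y, -, rfl⟩
    rw [good_eq hs hg y]
    have : 0 ≤ (y - x) ⬝ᵥ (Hm Y l *ᵥ (y - x)) := by
      simpa using hPD.posSemidef.dotProduct_mulVec_nonneg (y - x)
    linarith
  have hc : Continuous fun t : ℝ => Pc Y Vs x + t • l := by fun_prop
  have hev : ∀ᶠ t : ℝ in nhdsWithin 0 (Ioi 0), Pc Y Vs x + t • l ∈ convexHull ℝ (Fset Y Vs) := by
    apply nhdsWithin_le_nhds
    apply hc.continuousAt.eventually_mem
    simpa using mem_interior_iff_mem_nhds.1 hint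
  obtain ⟨t, ht, ht0⟩ := (hev.and self_mem_nhdsWithin).exists
  have ht0 : 0 < t := ht0
  have := hull_le hF (subset_closure ht)
  rw [dotProduct_add, dotProduct_smul, smul_eq_mul] at this
  have hll : 0 < l ⬝ᵥ l := by
    simp only [dotProduct]
    have : Nonempty (Fin n) := ⟨⟨0, hn⟩⟩
    exact Finset.sum_pos (fun i _ => mul_pos (hg.1 i) (hg.1 i)) Finset.univ_nonempty
  have := mul_pos ht0 hll
  linarith

lemma good_inj (hn : 1 ≤ n) {Y : Matrix (Fin n) (Fin n) ℝ} (hs : ∀ i j, Y i j = Y j i)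
    (hZ : IsZmat Y) (hirr : IsIrred Y) {Vs : Fin n → ℝ}
    (hInn : ∀ i, 0 ≤ (Y *ᵥ Vs) i) (hIne : Y *ᵥ Vs ≠ 0) {l x : Fin n → ℝ}
    (hg : Good Y Vs l x) {y : Fin n → ℝ} (h : Pc Y Vs x = Pc Y Vs y) : x = y := by
  have hPD := good_PD hn hs hZ hirr hInn hIne hg
  by_contra hne
  have := PD_pos hPD (z := y - x) (sub_ne_zero.2 (Ne.symm hne))
  have h2 := good_eq hs hg y
  rw [← h] at h2
  linarith

end aux3
section aux4
variable {n : ℕ}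

lemma quad_aux {a q u : ℝ} (h : ∀ t : ℝ, 0 ≤ t → t * a - t ^ 2 * q / 2 ≤ u) :
    0 ≤ q ∧ (q = 0 → a ≤ 0) := by
  constructor
  · by_contra hq
    have hq : 0 < -q / 2 := by linarith
    set p := -q / 2 with hp
    set s := (|a| + |u| + 1) / p + 1 with hs
    have h1 : 0 ≤ (|a| + |u| + 1) / p := by positivity
    have h2 : (|a| + |u| + 1) ≤ s * p := by
      have : (|a| + |u| + 1) / p * p = |a| + |u| + 1 := by field_simp
      rw [hs, add_mul, this]; linarith
    have hs1 : 1 ≤ s := by linarith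
    have h3 := h s (by linarith)
    have e : s * a - s ^ 2 * q / 2 = s * (a + s * p) := by rw [hp]; ring
    rw [e] at h3
    have h4 : |u| + 1 ≤ a + s * p := by linarith [neg_abs_le a]
    have h5 : |u| + 1 ≤ s * (a + s * p) := by nlinarith [abs_nonneg u]
    linarith [le_abs_self u]
  · intro hq
    by_contra ha
    have ha : 0 < a := not_le.1 ha
    have h1 := h ((|u| + 1) / a) (by positivity)
    have : (|u| + 1) / a * a = |u| + 1 := by field_simp
    rw [hq, this] at h1
    simp at h1
    linarith [le_abs_self u]

lemma Q_abs {H : Matrix (Fin n) (Fin n) ℝ} (hZ : IsZmat H) (z : Fin n → ℝ) :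
    (fun i => |z i|) ⬝ᵥ (H *ᵥ (fun i => |z i|)) ≤ z ⬝ᵥ (H *ᵥ z) := by
  rw [dot_eq, dot_eq]
  refine Finset.sum_le_sum fun i _ => Finset.sum_le_sum fun j _ => ?_
  by_cases h : i = j
  · subst h
    rw [mul_assoc, mul_assoc, abs_mul_abs_self]
  · rw [mul_assoc, mul_assoc, ← abs_mul]
    exact mul_le_mul_of_nonpos_left (le_abs_self _) (hZ i j h)

lemma exists_good (hn : 1 ≤ n) {Y : Matrix (Fin n) (Fin n) ℝ} (hPD : Y.PosDef)
    (hs : ∀ i j, Y i j = Y j i)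
    (hZ : IsZmat Y) (hirr : IsIrred Y) {Vs : Fin n → ℝ}
    (hInn : ∀ i, 0 ≤ (Y *ᵥ Vs) i) (hIne : Y *ᵥ Vs ≠ 0) {l : Fin n → ℝ} (hl0 : l ≠ 0) {u : ℝ}
    (hu : ∀ x : Fin n → ℝ, (∀ i, 0 < x i) → l ⬝ᵥ Pc Y Vs x ≤ u) : ∃ x, Good Y Vs l x := by
  have hsH := Hm_symm hs l
  -- extend to the closed orthant
  have hA : ∀ x : Fin n → ℝ, (∀ i, 0 ≤ x i) →
      ∑ i, l i * x i * (Y *ᵥ Vs) i - (x ⬝ᵥ (Hm Y l *ᵥ x)) / 2 ≤ u := by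
    intro x hx
    have hc : Continuous fun x : Fin n → ℝ =>
        ∑ i, l i * x i * (Y *ᵥ Vs) i - (x ⬝ᵥ (Hm Y l *ᵥ x)) / 2 := by
      simp only [dot_eq]
      generalize Y *ᵥ Vs = w
      generalize Hm Y l = H
      fun_prop
    have hcl : IsClosed {x : Fin n → ℝ |
        ∑ i, l i * x i * (Y *ᵥ Vs) i - (x ⬝ᵥ (Hm Y l *ᵥ x)) / 2 ≤ u} :=
      isClosed_le hc continuous_const
    have ht : Filter.Tendsto (fun t : ℝ => x + t • (1 : Fin n → ℝ))
        (nhdsWithin 0 (Ioi 0)) (nhds x) := by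
      have hc : Continuous (fun t : ℝ => x + t • (1 : Fin n → ℝ)) := by fun_prop
      have := hc.tendsto 0
      simp only [zero_smul, add_zero] at this
      exact this.mono_left nhdsWithin_le_nhds
    refine hcl.mem_of_tendsto ht ?_
    filter_upwards [self_mem_nhdsWithin] with t ht
    have ht : 0 < t := ht
    have := hu (x + t • (1 : Fin n → ℝ)) (fun i => by
      simp only [Pi.add_apply, Pi.smul_apply, Pi.one_apply, smul_eq_mul, mul_one]
      linarith [hx i])
    rw [lPc hs] at this
    exact this
  have hB : ∀ x : Fin n → ℝ, (∀ i, 0 ≤ x i) → 0 ≤ x ⬝ᵥ (Hm Y l *ᵥ x) ∧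
      (x ⬝ᵥ (Hm Y l *ᵥ x) = 0 → ∑ i, l i * x i * (Y *ᵥ Vs) i ≤ 0) := by
    intro x hx
    apply quad_aux (u := u)
    intro t ht
    have := hA (t • x) (fun i => mul_nonneg ht (hx i))
    rw [Matrix.mulVec_smul, smul_dotProduct, dotProduct_smul] at this
    simp only [smul_eq_mul, Pi.smul_apply] at this
    have e : ∑ i, l i * (t * x i) * (Y *ᵥ Vs) i = t * ∑ i, l i * x i * (Y *ᵥ Vs) i := by
      rw [Finset.mul_sum]; exact Finset.sum_congr rfl fun i _ => by ring
    rw [e] at this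
    linarith
  have hlnn : ∀ i, 0 ≤ l i := by
    intro i
    have h := (hB (Pi.single i 1) (fun j => by
      by_cases h : j = i
      · subst h; simp
      · simp [h])).1
    rw [Matrix.mulVec_single_one, single_dotProduct] at h
    simp [Hm] at h
    have hd : 0 < Y i i := hPD.diag_pos
    by_contra hc
    have : l i < 0 := not_le.1 hc
    nlinarith
  have hl : ∀ i, 0 < l i := by
    rcases aux_S hZ hirr hlnn (fun i hi => by
      by_contra hc
      have hc : (Y *ᵥ l) i < 0 := not_le.1 hc
      have e : ∀ s : ℝ, (1 - Pi.single i (-s)) ⬝ᵥ (Hm Y l *ᵥ (1 - Pi.single i (-s)))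
          = 1 ⬝ᵥ (Hm Y l *ᵥ 1) + 2 * s * (Y *ᵥ l) i := by
        intro s
        have e1 : (Hm Y l *ᵥ 1) i = (Y *ᵥ l) i := by
          rw [Hm_mulVec]
          simp only [hi, zero_add, Pi.one_apply, mul_one]
          have : (Y *ᵥ l) i = ∑ j, Y i j * l j := rfl
          rw [this]
          exact Finset.sum_congr rfl fun j _ => by ring
        have e2 : (Hm Y l *ᵥ Pi.single i (-s)) i = 0 := by
          simp [Hm, hi]
        rw [Q_sub hsH, dot_symm hsH 1 (Pi.single i (-s)), single_dotProduct, single_dotProduct, e1, e2]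
        ring
      have hq : ∀ s : ℝ, 0 ≤ s → 0 ≤ 1 ⬝ᵥ (Hm Y l *ᵥ 1) + 2 * s * (Y *ᵥ l) i := by
        intro s hs0
        rw [← e]
        refine (hB _ fun j => ?_).1
        by_cases h : j = i
        · subst h; simp; linarith
        · simp [h]
      have h0 := hq 0 le_rfl
      have h1 := hq ((1 ⬝ᵥ (Hm Y l *ᵥ 1) + 1) / (-(Y *ᵥ l) i)) (by
        apply div_nonneg <;> linarith)
      have : (1 ⬝ᵥ (Hm Y l *ᵥ 1) + 1) / (-(Y *ᵥ l) i) * (Y *ᵥ l) i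
          = -(1 ⬝ᵥ (Hm Y l *ᵥ 1) + 1) := by
        have := hc.ne
        field_simp
      linarith) with h | h
    · exact absurd h hl0
    · exact h
  have hZH := Hm_Z hZ hl
  have hirrH := Hm_irr hirr hl
  have hPSD : (Hm Y l).PosSemidef := mkPSD hsH fun z =>
    ((hB (fun i => |z i|) (fun i => abs_nonneg _)).1).trans (Q_abs hZH z)
  have hunit : IsUnit (Hm Y l).det := by
    rw [isUnit_iff_ne_zero]
    intro h0
    obtain ⟨v, hv, hv0⟩ := Matrix.exists_mulVec_eq_zero_iff.2 h0
    have h1 := Q_abs hZH v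
    rw [hv0, dotProduct_zero] at h1
    obtain ⟨h2, h3⟩ := hB (fun i => |v i|) (fun i => abs_nonneg _)
    have h4 := le_antisymm h1 h2
    have h5 : Hm Y l *ᵥ (fun i => |v i|) = 0 :=
      (hPSD.dotProduct_mulVec_zero_iff _).1 (by simpa using h4)
    rcases aux_S hZH hirrH (z := fun i => |v i|) (fun i => abs_nonneg _)
      (fun i _ => by rw [h5]; simp) with h | h
    · apply hv; funext i; simpa using congrFun h i
    · have h6 := h3 h4
      obtain ⟨j, hj⟩ := Function.ne_iff.1 hIne
      have hj : 0 < (Y *ᵥ Vs) j := lt_of_le_of_ne (hInn j) (Ne.symm hj)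
      have : 0 < ∑ i, l i * |v i| * (Y *ᵥ Vs) i :=
        Finset.sum_pos' (fun i _ => mul_nonneg (mul_nonneg (hlnn i) (abs_nonneg _)) (hInn i))
          ⟨j, Finset.mem_univ _, mul_pos (mul_pos (hl j) (h j)) hj⟩
      linarith
  have hPDH : (Hm Y l).PosDef := by
    rw [hPSD.posDef_iff_isUnit, Matrix.isUnit_iff_isUnit_det]; exact hunit
  set w : Fin n → ℝ := fun i => l i * (Y *ᵥ Vs) i with hw
  have hw0 : ∀ i, 0 ≤ w i := fun i => mul_nonneg (hlnn i) (hInn i)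
  obtain ⟨x, hx⟩ : ∃ x, Hm Y l *ᵥ x = w := ⟨(Hm Y l)⁻¹ *ᵥ w, by
    rw [Matrix.mulVec_mulVec, Matrix.mul_nonsing_inv _ hunit, Matrix.one_mulVec]⟩
  have habs : (fun i => |x i|) = x := by
    by_contra hne
    have h1 := PD_pos hPDH (sub_ne_zero.2 hne)
    rw [Q_sub hsH] at h1
    have h2 := Q_abs hZH x
    rw [hx] at h1 h2
    have h3 : x ⬝ᵥ w ≤ (fun i => |x i|) ⬝ᵥ w :=
      Finset.sum_le_sum fun i _ => mul_le_mul_of_nonneg_right (le_abs_self _) (hw0 i)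
    linarith
  have hx0 : ∀ i, 0 ≤ x i := fun i => by
    rw [← congrFun habs i]; exact abs_nonneg _
  rcases aux_S hZH hirrH hx0 (fun i _ => by rw [hx]; exact hw0 i) with h | h
  · exfalso; apply hIne; funext i
    rw [h, Matrix.mulVec_zero] at hx
    have := congrFun hx i
    simp only [hw, Pi.zero_apply] at this
    rcases mul_eq_zero.1 this.symm with h | h
    · exact absurd h (hl i).ne'
    · exact h
  · exact ⟨x, hl, h, fun j => congrFun hx j⟩

lemma hull_int {Y : Matrix (Fin n) (Fin n) ℝ} (hPD : Y.PosDef) {Vs : Fin n → ℝ}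
    (hVs : ∀ i, 0 < Vs i) : (interior (convexHull ℝ (Fset Y Vs))).Nonempty := by
  rw [interior_convexHull_nonempty_iff_affineSpan_eq_top,
    AffineSubspace.affineSpan_eq_top_iff_vectorSpan_eq_top_of_nonempty ℝ _ _
      (show (Fset Y Vs).Nonempty from ⟨_, Vs, hVs, rfl⟩)]
  rw [eq_top_iff]
  intro v _
  have hunit : IsUnit Y.det := hPD.det_pos.ne'.isUnit
  obtain ⟨z, hz⟩ : ∃ z, Y *ᵥ z = fun i => v i / Vs i := ⟨Y⁻¹ *ᵥ (fun i => v i / Vs i), by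
    rw [Matrix.mulVec_mulVec, Matrix.mul_nonsing_inv _ hunit, Matrix.one_mulVec]⟩
  have ev1 : ∀ i, ∀ᶠ t : ℝ in nhdsWithin 0 (Ioi 0), 0 < (Vs + t • z) i := fun i => by
    apply nhdsWithin_le_nhds
    have hc : Continuous fun t : ℝ => (Vs + t • z) i := by
      simp only [Pi.add_apply, Pi.smul_apply]; fun_prop
    exact hc.continuousAt.eventually_const_lt (by simpa using hVs i)
  have ev2 : ∀ i, ∀ᶠ t : ℝ in nhdsWithin 0 (Ioi 0), 0 < (Vs - t • z) i := fun i => by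
    apply nhdsWithin_le_nhds
    have hc : Continuous fun t : ℝ => (Vs - t • z) i := by
      simp only [Pi.sub_apply, Pi.smul_apply]; fun_prop
    exact hc.continuousAt.eventually_const_lt (by simpa using hVs i)
  obtain ⟨t, ⟨h1, h2⟩, ht⟩ := (((Filter.eventually_all.2 ev1).and
    (Filter.eventually_all.2 ev2)).and self_mem_nhdsWithin).exists
  have ht : 0 < t := ht
  have hm : Pc Y Vs (Vs - t • z) -ᵥ Pc Y Vs (Vs + t • z) ∈ vectorSpan ℝ (Fset Y Vs) :=
    vsub_mem_vectorSpan ℝ ⟨_, h2, rfl⟩ ⟨_, h1, rfl⟩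
  have e : v = (2 * t)⁻¹ • (Pc Y Vs (Vs - t • z) -ᵥ Pc Y Vs (Vs + t • z)) := by
    funext i
    have := hVs i
    simp only [vsub_eq_sub, Pi.smul_apply, Pi.sub_apply, Pc_apply, Matrix.mulVec_sub,
      Matrix.mulVec_add, Matrix.mulVec_smul, hz, Pi.add_apply, smul_eq_mul]
    field_simp
    ring
  rw [e]
  exact Submodule.smul_mem _ _ hm

end aux4

theorem stmt_14 (n : ℕ) (hn : 1 ≤ n)
    (Y : Matrix (Fin n) (Fin n) ℝ)
    (hPD : Y.PosDef)
    (hZ : IsZmat Y)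
    (hirr : IsIrred Y)
    (Vs : Fin n → ℝ) (hVs : ∀ i, 0 < Vs i)
    (hInn : ∀ i, 0 ≤ (Y *ᵥ Vs) i) (hIne : Y *ᵥ Vs ≠ 0) :
    Set.BijOn (Pc Y Vs) (frontier (Dset Y Vs)) (frontier (convexHull ℝ (Fset Y Vs))) := by
  have hs : ∀ i j, Y i j = Y j i := fun i j => by
    simpa using hPD.isHermitian.apply j i
  refine ⟨fun x hx => ?_, fun x hx y hy h => ?_, fun P hP => ?_⟩
  · obtain ⟨l, hg⟩ := frontier_good hn hs hZ hirr hInn hIne hx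
    exact good_max hn hs hZ hirr hInn hIne hg
  · obtain ⟨l, hg⟩ := frontier_good hn hs hZ hirr hInn hIne hx
    exact good_inj hn hs hZ hirr hInn hIne hg h
  · obtain ⟨f, u, hf0, hfa, hfP⟩ := geometric_hahn_banach_of_nonempty_interior
      (convex_convexHull ℝ (Fset Y Vs)) (convex_singleton P)
      (Set.disjoint_singleton_right.2 hP.2) (hull_int hPD hVs) (Set.singleton_nonempty P)
    have hfP := hfP P rfl
    set l : Fin n → ℝ := fun i => f (Pi.single i 1) with hl
    have hfl : ∀ y, f y = l ⬝ᵥ y := by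
      intro y
      have := LinearMap.pi_apply_eq_sum_univ (f : (Fin n → ℝ) →ₗ[ℝ] ℝ) y
      simp only [ContinuousLinearMap.coe_coe, smul_eq_mul] at this
      rw [this]
      simp only [dotProduct, hl]
      refine Finset.sum_congr rfl fun i _ => ?_
      rw [mul_comm]
      congr 2
      funext j
      simp [Pi.single_apply, eq_comm]
    have hl0 : l ≠ 0 := by
      intro h
      apply hf0
      ext y
      rw [hfl, h]; simp
    have hu : ∀ x : Fin n → ℝ, (∀ i, 0 < x i) → l ⬝ᵥ Pc Y Vs x ≤ u := fun x hx => by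
      rw [← hfl]; exact hfa _ (subset_convexHull ℝ _ ⟨x, hx, rfl⟩)
    obtain ⟨x, hg⟩ := exists_good hn hPD hs hZ hirr hInn hIne hl0 hu
    refine ⟨x, good_frontier hn hs hZ hirr hInn hIne hg, ?_⟩
    refine (good_uniq hn hs hZ hirr hInn hIne hg hP.1 ?_).symm
    rw [← hfl P]
    exact (hu x hg.2.1).trans hfP
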